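/- Let m ≤ n and let Φ : ℝ^{m×n} ⇉ ℝ^{m×n} be the subdifferential map of the nuclear norm, Φ(X) = ∂‖X‖_*. Then Φ is metrically sub-regular at every X₀ ∈ ℝ^{m×n} for every G₀ ∈ Φ(X₀): there exist κ, ε > 0 such that d(X, Φ⁻¹(G₀)) ≤ κ·d(G₀, Φ(X)) for all X ∈ ℝ^{m×n} with ‖X − X₀‖_F ≤ ε, where Φ⁻¹(G₀) = {Z : G₀ ∈ ∂‖Z‖_*} and distances are measured in the Frobenius norm. -/

import Mathlib

open Matrix
open scoped NNReal

-- matrices are equipped with the Frobenius norm throughout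
attribute [local instance] Matrix.frobeniusNormedAddCommGroup

/-- The nuclear norm of a real matrix: the sum of its singular values, i.e. of the
square roots of the eigenvalues of `X * Xᵀ`. -/
noncomputable def nuclearNorm {m n : ℕ} (X : Matrix (Fin m) (Fin n) ℝ) : ℝ :=
  ∑ i, Real.sqrt ((Matrix.isHermitian_mul_conjTranspose_self X).eigenvalues i)

/-- The trace (Frobenius) inner product `⟨G, X⟩ = trace (Gᵀ * X)` on real matrices. -/
noncomputable def frobInner {m n : ℕ} (G X : Matrix (Fin m) (Fin n) ℝ) : ℝ :=
  ∑ i, ∑ j, G i j * X i j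

/-- The subdifferential of the nuclear norm with respect to the trace inner product. -/
def nucSubdiff {m n : ℕ} (X : Matrix (Fin m) (Fin n) ℝ) : Set (Matrix (Fin m) (Fin n) ℝ) :=
  {G : Matrix (Fin m) (Fin n) ℝ | ∀ Z : Matrix (Fin m) (Fin n) ℝ,
    nuclearNorm X + frobInner G (Z - X) ≤ nuclearNorm Z}

section Auxiliary

variable {m n : ℕ}

lemma frobInner_eq_trace (G X : Matrix (Fin m) (Fin n) ℝ) :
    frobInner G X = (G * Xᵀ).trace := by
  simp [frobInner, Matrix.trace, Matrix.mul_apply]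

lemma frobenius_norm_sq_eq_trace (A : Matrix (Fin m) (Fin n) ℝ) :
    ‖A‖ ^ 2 = (A * Aᵀ).trace := by
  have h : 0 ≤ ∑ i, ∑ j, ‖A i j‖ ^ (2 : ℝ) := by positivity
  rw [Matrix.frobenius_norm_def, ← Real.sqrt_eq_rpow, Real.sq_sqrt h]
  simp [Matrix.trace, Matrix.mul_apply, sq]

/-- Real spectral theorem, in terms of an orthogonal matrix and its transpose. -/
lemma exists_orthogonal_diagonalization {A : Matrix (Fin m) (Fin m) ℝ} (hA : A.IsHermitian) :
    ∃ U : Matrix (Fin m) (Fin m) ℝ, Uᵀ * U = 1 ∧ U * Uᵀ = 1 ∧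
      A = U * diagonal hA.eigenvalues * Uᵀ := by
  refine ⟨hA.eigenvectorUnitary, ?_, ?_, ?_⟩
  · simpa [star_eq_conjTranspose] using Unitary.coe_star_mul_self hA.eigenvectorUnitary
  · simpa [star_eq_conjTranspose] using Unitary.coe_mul_star_self hA.eigenvectorUnitary
  · have h := hA.spectral_theorem
    rw [Unitary.conjStarAlgAut_apply] at h
    simpa [star_eq_conjTranspose, Function.comp_def] using h

open scoped MatrixOrder in
lemma Matrix.PosSemidef.eq_of_mul_self_eq_mul_self {P R : Matrix (Fin m) (Fin m) ℝ}
    (hP : P.PosSemidef) (hR : R.PosSemidef) (h : P * P = R * R) : P = R := by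
  rw [← CFC.sqrt_unique rfl hP.nonneg, h, CFC.sqrt_unique rfl hR.nonneg]

open scoped MatrixOrder in
lemma Matrix.PosSemidef.mul_eq_zero_of_conj_eq_zero {A P : Matrix (Fin m) (Fin m) ℝ}
    (hA : A.PosSemidef) (h : Pᴴ * A * P = 0) : A * P = 0 := by
  obtain ⟨C, rfl⟩ := CStarAlgebra.nonneg_iff_eq_star_mul_self.mp hA.nonneg
  have h' : (C * P)ᴴ * (C * P) = 0 := by
    rw [← h, star_eq_conjTranspose, conjTranspose_mul]
    simp only [Matrix.mul_assoc]
  rw [Matrix.mul_assoc, Matrix.conjTranspose_mul_self_eq_zero.1 h', Matrix.mul_zero]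

/-- Simultaneous description of the left singular vectors and the singular values. -/
lemma exists_left_singular_decomposition (X : Matrix (Fin m) (Fin n) ℝ) :
    ∃ (U : Matrix (Fin m) (Fin m) ℝ) (s : Fin m → ℝ), Uᵀ * U = 1 ∧ U * Uᵀ = 1 ∧ 0 ≤ s ∧
      X * Xᵀ = U * diagonal (fun i => s i * s i) * Uᵀ ∧ nuclearNorm X = ∑ i, s i := by
  have hX := Matrix.isHermitian_mul_conjTranspose_self X
  obtain ⟨U, h₁, h₂, h₃⟩ := exists_orthogonal_diagonalization hX
  refine ⟨U, fun i => √(hX.eigenvalues i), h₁, h₂, fun i => Real.sqrt_nonneg _, ?_, rfl⟩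
  have hnn := (Matrix.posSemidef_self_mul_conjTranspose X).eigenvalues_nonneg
  simp only [Real.mul_self_sqrt (hnn _)]
  rwa [← conjTranspose_eq_transpose_of_trivial X]

lemma orthogonal_conj_mul {U : Matrix (Fin m) (Fin m) ℝ} (h : Uᵀ * U = 1)
    (A B : Matrix (Fin m) (Fin m) ℝ) : (U * A * Uᵀ) * (U * B * Uᵀ) = U * (A * B) * Uᵀ := by
  calc _ = U * A * (Uᵀ * U) * B * Uᵀ := by simp only [Matrix.mul_assoc]
    _ = _ := by rw [h]; simp only [Matrix.mul_assoc, Matrix.mul_one]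

lemma orthogonal_conj_trace {U : Matrix (Fin m) (Fin m) ℝ} (h : Uᵀ * U = 1)
    (A : Matrix (Fin m) (Fin m) ℝ) : (U * A * Uᵀ).trace = A.trace := by
  rw [Matrix.trace_mul_comm, ← Matrix.mul_assoc, h, Matrix.one_mul]

lemma orthogonal_conj_diagonal_posSemidef (U : Matrix (Fin m) (Fin m) ℝ) {s : Fin m → ℝ}
    (hs : 0 ≤ s) : (U * diagonal s * Uᵀ).PosSemidef := by
  simpa using (Matrix.PosSemidef.diagonal hs).mul_mul_conjTranspose_same U

/-- The nuclear norm is the trace of the positive semidefinite square root of `X * Xᵀ`. -/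
lemma nuclearNorm_eq_trace {X : Matrix (Fin m) (Fin n) ℝ} {P : Matrix (Fin m) (Fin m) ℝ}
    (hP : P.PosSemidef) (h : X * Xᵀ = P * P) : nuclearNorm X = P.trace := by
  obtain ⟨U, s, h₁, -, hs, hX, hN⟩ := exists_left_singular_decomposition X
  have hR : P = U * diagonal s * Uᵀ := by
    refine hP.eq_of_mul_self_eq_mul_self (orthogonal_conj_diagonal_posSemidef U hs) ?_
    rw [orthogonal_conj_mul h₁, diagonal_mul_diagonal, ← h, hX]
  rw [hR, orthogonal_conj_trace h₁, hN, trace_diagonal]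

lemma nuclearNorm_zero : nuclearNorm (0 : Matrix (Fin m) (Fin n) ℝ) = 0 := by
  rw [nuclearNorm_eq_trace Matrix.PosSemidef.zero (by simp), Matrix.trace_zero]

lemma nuclearNorm_two_smul (X : Matrix (Fin m) (Fin n) ℝ) :
    nuclearNorm ((2 : ℝ) • X) = 2 * nuclearNorm X := by
  obtain ⟨U, s, h₁, -, hs, hX, hN⟩ := exists_left_singular_decomposition X
  have hP := orthogonal_conj_diagonal_posSemidef U hs
  rw [nuclearNorm_eq_trace (hP.smul (zero_le_two (α := ℝ))), Matrix.trace_smul,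
    orthogonal_conj_trace h₁, hN, trace_diagonal, smul_eq_mul]
  simp [orthogonal_conj_mul h₁, hX, diagonal_mul_diagonal]

lemma nuclearNorm_vecMulVec (x : Fin m → ℝ) (y : Fin n → ℝ) :
    nuclearNorm (vecMulVec x y) = √(x ⬝ᵥ x) * √(y ⬝ᵥ y) := by
  have hx : 0 ≤ x ⬝ᵥ x := by simpa using dotProduct_star_self_nonneg x
  have hy : 0 ≤ y ⬝ᵥ y := by simpa using dotProduct_star_self_nonneg y
  rcases eq_or_ne x 0 with rfl | hx0
  · simp [nuclearNorm_zero]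
  have hx' : √(x ⬝ᵥ x) ≠ 0 := by
    rw [Real.sqrt_ne_zero hx]
    simpa using hx0
  have hpsd : ((√(y ⬝ᵥ y) / √(x ⬝ᵥ x)) • vecMulVec x x).PosSemidef := by
    have h := posSemidef_vecMulVec_self_star x
    rw [star_trivial] at h
    exact h.smul (by positivity)
  rw [nuclearNorm_eq_trace hpsd]
  · rw [trace_smul, trace_vecMulVec, smul_eq_mul]
    nth_rewrite 2 [← Real.mul_self_sqrt hx]
    field_simp
  · rw [transpose_vecMulVec, vecMulVec_mul_vecMulVec, smul_mul_smul_comm,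
      vecMulVec_mul_vecMulVec, vecMulVec_smul, vecMulVec_smul,
      smul_smul]
    congr 1
    nth_rewrite 1 [← Real.mul_self_sqrt hy]
    nth_rewrite 3 [← Real.mul_self_sqrt hx]
    field_simp

lemma nuclearNorm_eq_frobInner_of_mem {X G : Matrix (Fin m) (Fin n) ℝ} (hG : G ∈ nucSubdiff X) :
    nuclearNorm X = frobInner G X := by
  have h0 := hG 0
  have h2 := hG ((2 : ℝ) • X)
  rw [nuclearNorm_zero] at h0
  rw [nuclearNorm_two_smul] at h2
  simp only [frobInner_eq_trace, two_smul, add_sub_cancel_right, zero_sub, transpose_neg,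
    Matrix.mul_neg, trace_neg] at h0 h2 ⊢
  linarith

lemma frobInner_le_nuclearNorm_of_mem {X G : Matrix (Fin m) (Fin n) ℝ} (hG : G ∈ nucSubdiff X)
    (Z : Matrix (Fin m) (Fin n) ℝ) : frobInner G Z ≤ nuclearNorm Z := by
  have h := hG Z
  rw [nuclearNorm_eq_frobInner_of_mem hG] at h
  simp only [frobInner_eq_trace, transpose_sub, Matrix.mul_sub, trace_sub] at h ⊢
  linarith

/-- Subgradients of the nuclear norm have operator norm at most one. -/
lemma posSemidef_one_sub_mul_transpose {X G : Matrix (Fin m) (Fin n) ℝ}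
    (hG : G ∈ nucSubdiff X) : (1 - G * Gᵀ).PosSemidef := by
  refine Matrix.PosSemidef.of_dotProduct_mulVec_nonneg ?_ fun x => ?_
  · simp [IsHermitian]
  have h := frobInner_le_nuclearNorm_of_mem hG (vecMulVec x (Gᵀ *ᵥ x))
  have hx : 0 ≤ x ⬝ᵥ x := by simpa using dotProduct_star_self_nonneg x
  have hy : 0 ≤ (Gᵀ *ᵥ x) ⬝ᵥ (Gᵀ *ᵥ x) := by
    simpa using dotProduct_star_self_nonneg (Gᵀ *ᵥ x)
  have e : frobInner G (vecMulVec x (Gᵀ *ᵥ x)) = (Gᵀ *ᵥ x) ⬝ᵥ (Gᵀ *ᵥ x) := by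
    rw [frobInner_eq_trace, transpose_vecMulVec, mul_vecMulVec, trace_vecMulVec,
      ← vecMul_transpose, ← dotProduct_mulVec]
  rw [e, nuclearNorm_vecMulVec] at h
  have e2 : x ⬝ᵥ ((G * Gᵀ) *ᵥ x) = (Gᵀ *ᵥ x) ⬝ᵥ (Gᵀ *ᵥ x) := by
    rw [← mulVec_mulVec, dotProduct_mulVec, ← mulVec_transpose]
  rw [star_trivial, sub_mulVec, one_mulVec, dotProduct_sub, e2, sub_nonneg]
  rw [← Real.sqrt_le_sqrt_iff hx]
  rcases (Real.sqrt_nonneg ((Gᵀ *ᵥ x) ⬝ᵥ (Gᵀ *ᵥ x))).eq_or_lt with h0 | h0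
  · rw [← h0]; positivity
  · nth_rewrite 1 [← Real.mul_self_sqrt hy] at h
    exact le_of_mul_le_mul_right h h0

/-- A subgradient `G` of the nuclear norm at `X` is a polar factor of `X`, acting isometrically
on the range of the positive semidefinite factor. -/
lemma exists_polar_of_mem {X G : Matrix (Fin m) (Fin n) ℝ} (hG : G ∈ nucSubdiff X) :
    ∃ P : Matrix (Fin m) (Fin m) ℝ, P.PosSemidef ∧ X = P * G ∧ G * Gᵀ * P = P ∧ ‖P‖ = ‖X‖ := by
  obtain ⟨U, s, h₁, h₂, hs, hX, hN⟩ := exists_left_singular_decomposition X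
  set P := U * diagonal s * Uᵀ with hPdef
  have hP : P.PosSemidef := orthogonal_conj_diagonal_posSemidef U hs
  have hPt : Pᵀ = P := by simpa [IsHermitian] using hP.isHermitian
  have hPP : X * Xᵀ = P * P := by
    rw [hPdef, orthogonal_conj_mul h₁, diagonal_mul_diagonal, hX]
  have hA := posSemidef_one_sub_mul_transpose hG
  set x := Uᵀ * X with hx
  set g := Uᵀ * G with hg
  have hxx : x * xᵀ = diagonal fun i => s i * s i := by
    calc x * xᵀ = Uᵀ * (X * Xᵀ) * U := by simp [hx, Matrix.mul_assoc]
      _ = (Uᵀ * U) * (diagonal fun i => s i * s i) * (Uᵀ * U) := by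
        rw [hX]; simp only [Matrix.mul_assoc]
      _ = _ := by rw [h₁]; simp
  have hgg : ∀ i, (g * gᵀ) i i ≤ 1 := by
    intro i
    have h := (hA.conjTranspose_mul_mul_same U).diag_nonneg (i := i)
    rw [conjTranspose_eq_transpose_of_trivial, Matrix.mul_sub, Matrix.sub_mul, Matrix.mul_one,
      h₁] at h
    have e : Uᵀ * (G * Gᵀ) * U = g * gᵀ := by simp [hg, Matrix.mul_assoc]
    rw [e] at h
    simpa using h
  have hsum : ∑ i, (g * xᵀ) i i = ∑ i, s i := by
    have e : (g * xᵀ).trace = (G * Xᵀ).trace := by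
      rw [hg, hx, transpose_mul, transpose_transpose, ← Matrix.mul_assoc, Matrix.trace_mul_comm,
        ← Matrix.mul_assoc, ← Matrix.mul_assoc, h₂, Matrix.one_mul]
    rw [← hN, nuclearNorm_eq_frobInner_of_mem hG, frobInner_eq_trace, ← e, Matrix.trace]
    rfl
  have hsq : ∀ i, ∑ j, (x i j - s i * g i j) ^ 2 =
      s i * s i - 2 * s i * (g * xᵀ) i i + s i * s i * (g * gᵀ) i i := by
    intro i
    have e : s i * s i = ∑ j, x i j * x i j := by
      have := congrFun (congrFun hxx i) i
      simpa [Matrix.mul_apply] using this.symm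
    rw [add_comm, ← sub_eq_zero]
    nth_rewrite 2 [e]
    simp only [Matrix.mul_apply, Matrix.transpose_apply, Finset.mul_sum,
      ← Finset.sum_add_distrib, ← Finset.sum_sub_distrib]
    exact Finset.sum_eq_zero fun j _ => by ring
  have hle : ∀ i, (g * xᵀ) i i ≤ s i := by
    intro i
    rcases (hs i).eq_or_lt with h0 | h0
    · have h0' : s i = 0 := h0.symm
      have h := hsq i
      simp only [h0', zero_mul, sub_zero, mul_zero, add_zero] at h
      have hz := (Finset.sum_eq_zero_iff_of_nonneg fun j _ => sq_nonneg (x i j)).1 h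
      have hz' : ∀ j, x i j = 0 := fun j => by simpa using hz j (Finset.mem_univ j)
      simp [Matrix.mul_apply, hz', h0']
    · have h : 0 ≤ ∑ j, (x i j - s i * g i j) ^ 2 := by positivity
      rw [hsq i] at h
      have h0' : 0 < s i := h0
      have h3 := mul_le_mul_of_nonneg_left (hgg i) (mul_self_nonneg (s i))
      nlinarith
  have heq : ∀ i, (g * xᵀ) i i = s i := fun i =>
    (Finset.sum_eq_sum_iff_of_le fun i _ => hle i).1 hsum i (Finset.mem_univ i)
  have hxg : x = diagonal s * g := by
    ext i j
    have h3 := mul_le_mul_of_nonneg_left (hgg i) (mul_self_nonneg (s i))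
    have h : ∑ j, (x i j - s i * g i j) ^ 2 = 0 := by
      refine le_antisymm ?_ (by positivity)
      rw [hsq i, heq i]
      linarith
    have hz := (Finset.sum_eq_zero_iff_of_nonneg fun j _ => sq_nonneg _).1 h j (Finset.mem_univ j)
    rw [diagonal_mul]
    exact sub_eq_zero.1 (by simpa using hz)
  have hXPG : X = P * G := by
    calc X = (U * Uᵀ) * X := by rw [h₂, Matrix.one_mul]
      _ = U * x := by rw [hx, Matrix.mul_assoc]
      _ = P * G := by rw [hxg, hPdef, hg]; simp only [Matrix.mul_assoc]
  refine ⟨P, hP, hXPG, ?_, ?_⟩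
  · have h0 : Pᴴ * (1 - G * Gᵀ) * P = 0 := by
      have e : P * P = P * (G * Gᵀ) * P := by
        rw [← hPP]; nth_rewrite 1 2 [hXPG]; simp [hPt, Matrix.mul_assoc]
      rw [conjTranspose_eq_transpose_of_trivial, hPt, Matrix.mul_sub, Matrix.sub_mul, ← e]
      simp
    have h1 := hA.mul_eq_zero_of_conj_eq_zero h0
    rw [Matrix.sub_mul, Matrix.one_mul] at h1
    exact (sub_eq_zero.1 h1).symm
  · rw [← sq_eq_sq₀ (norm_nonneg _) (norm_nonneg _), frobenius_norm_sq_eq_trace,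
      frobenius_norm_sq_eq_trace, hPt, hPP]

/-- Every matrix `Q * G` with `Q` positive semidefinite supported where `G` is isometric has `G`
as a subgradient. -/
lemma mem_nucSubdiff_mul {X G : Matrix (Fin m) (Fin n) ℝ} (hG : G ∈ nucSubdiff X)
    {Q : Matrix (Fin m) (Fin m) ℝ} (hQ : Q.PosSemidef) (h : G * Gᵀ * Q = Q) :
    G ∈ nucSubdiff (Q * G) := by
  have hQt : Qᵀ = Q := by simpa [IsHermitian] using hQ.isHermitian
  have hN : nuclearNorm (Q * G) = Q.trace := by
    refine nuclearNorm_eq_trace hQ ?_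
    rw [transpose_mul, hQt, Matrix.mul_assoc, ← Matrix.mul_assoc G, h]
  intro Z
  refine le_trans (le_of_eq ?_) (frobInner_le_nuclearNorm_of_mem hG Z)
  simp only [hN, frobInner_eq_trace, transpose_sub, Matrix.mul_sub, trace_sub, transpose_mul, hQt,
    ← Matrix.mul_assoc, h]
  ring

lemma frobenius_norm_le_of_mem {X G : Matrix (Fin m) (Fin n) ℝ} (hG : G ∈ nucSubdiff X) :
    ‖G‖ ≤ m + 1 := by
  have h := (posSemidef_one_sub_mul_transpose hG).trace_nonneg
  rw [trace_sub, trace_one, ← frobenius_norm_sq_eq_trace, Fintype.card_fin] at h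
  have hm : (0 : ℝ) ≤ m := Nat.cast_nonneg m
  exact abs_le_of_sq_le_sq' (by nlinarith) (by positivity) |>.2

/-- A symmetric matrix `A` has a left inverse modulo the orthogonal projection onto its kernel. -/
lemma exists_pseudo_inverse {A : Matrix (Fin m) (Fin m) ℝ} (hA : A.IsHermitian) :
    ∃ B : Matrix (Fin m) (Fin m) ℝ, (B * A)ᵀ = B * A ∧ A * (1 - B * A) = 0 := by
  obtain ⟨U, h₁, h₂, h₃⟩ := exists_orthogonal_diagonalization hA
  set d := hA.eigenvalues
  have e : U * diagonal (fun i => (d i)⁻¹) * Uᵀ * A =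
      U * diagonal (fun i => (d i)⁻¹ * d i) * Uᵀ := by
    rw [h₃, orthogonal_conj_mul h₁, diagonal_mul_diagonal]
  refine ⟨U * diagonal (fun i => (d i)⁻¹) * Uᵀ, ?_, ?_⟩
  · rw [e]
    simp [Matrix.mul_assoc]
  · rw [e, Matrix.mul_sub, Matrix.mul_one]
    nth_rewrite 2 [h₃]
    rw [orthogonal_conj_mul h₁, diagonal_mul_diagonal]
    have : (fun i => d i * ((d i)⁻¹ * d i)) = d := by
      ext i
      rcases eq_or_ne (d i) 0 with h | h
      · simp [h]
      · field_simp
    rw [this, ← h₃, sub_self]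

/-- Global error bound for the inverse subdifferential, relative to the size of `X`. -/
lemma exists_infDist_le (X₀ G₀ : Matrix (Fin m) (Fin n) ℝ) (hG₀ : G₀ ∈ nucSubdiff X₀) :
    ∃ c : ℝ, 0 ≤ c ∧ ∀ X : Matrix (Fin m) (Fin n) ℝ, ∀ G ∈ nucSubdiff X,
      Metric.infDist X {Z : Matrix (Fin m) (Fin n) ℝ | G₀ ∈ nucSubdiff Z} ≤
        c * ‖X‖ * ‖G - G₀‖ := by
  have hA := posSemidef_one_sub_mul_transpose hG₀
  set A := 1 - G₀ * G₀ᵀ with hAdef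
  obtain ⟨B, hBt, hB⟩ := exists_pseudo_inverse hA.isHermitian
  set E := 1 - B * A with hE
  have hEt : Eᵀ = E := by rw [hE, transpose_sub, hBt, transpose_one]
  set g : ℝ := m + 1 with hgdef
  have hg : 0 ≤ g := by positivity
  refine ⟨1 + (1 + ‖E‖) * (‖B‖ * (g + g)) * g, by positivity, fun X G hG => ?_⟩
  obtain ⟨P, hP, hX, hGP, hPX⟩ := exists_polar_of_mem hG
  have hPt : Pᵀ = P := by simpa [IsHermitian] using hP.isHermitian
  have hgG := frobenius_norm_le_of_mem hG
  have hgG₀ := frobenius_norm_le_of_mem hG₀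
  have hQ : (E * P * E).PosSemidef := by
    simpa [hEt] using hP.mul_mul_conjTranspose_same E
  have hQE : G₀ * G₀ᵀ * (E * P * E) = E * P * E := by
    have h0 : A * (E * P * E) = 0 := by
      rw [← Matrix.mul_assoc, ← Matrix.mul_assoc, hB, Matrix.zero_mul, Matrix.zero_mul]
    rw [hAdef, Matrix.sub_mul, Matrix.one_mul] at h0
    exact (sub_eq_zero.1 h0).symm
  have hmem := mem_nucSubdiff_mul hG₀ hQ hQE
  have hAP : ‖A * P‖ ≤ (g + g) * ‖G - G₀‖ * ‖P‖ := by
    have e : A * P = (G * (G - G₀)ᵀ + (G - G₀) * G₀ᵀ) * P := by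
      rw [hAdef, Matrix.sub_mul, Matrix.one_mul]
      nth_rewrite 1 [← hGP]
      rw [← Matrix.sub_mul]
      congr 1
      rw [transpose_sub, Matrix.mul_sub, Matrix.sub_mul]
      abel
    rw [e]
    refine (frobenius_norm_mul _ _).trans ?_
    gcongr
    refine (norm_add_le _ _).trans ?_
    rw [add_mul]
    refine add_le_add ((frobenius_norm_mul _ _).trans ?_) ((frobenius_norm_mul _ _).trans ?_)
    · rw [frobenius_norm_transpose]; gcongr
    · rw [frobenius_norm_transpose, mul_comm]; gcongr
  have hBAP : ‖B * A * P‖ ≤ ‖B‖ * ((g + g) * ‖G - G₀‖ * ‖P‖) := by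
    rw [Matrix.mul_assoc]
    refine (frobenius_norm_mul _ _).trans ?_
    gcongr
  have hPQ : ‖P - E * P * E‖ ≤ (1 + ‖E‖) * (‖B‖ * ((g + g) * ‖G - G₀‖ * ‖P‖)) := by
    have e : P - E * P * E = B * A * P + E * (B * A * P)ᵀ := by
      rw [transpose_mul, hBt, hPt]
      have e1 : B * A = 1 - E := by rw [hE]; abel
      rw [e1]
      noncomm_ring
    rw [e, add_mul, one_mul]
    refine (norm_add_le _ _).trans (add_le_add hBAP ((frobenius_norm_mul _ _).trans ?_))
    rw [frobenius_norm_transpose]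
    gcongr
  calc Metric.infDist X {Z : Matrix (Fin m) (Fin n) ℝ | G₀ ∈ nucSubdiff Z}
      ≤ dist X (E * P * E * G₀) := Metric.infDist_le_dist_of_mem hmem
    _ = ‖P * (G - G₀) + (P - E * P * E) * G₀‖ := by
      rw [dist_eq_norm, Matrix.mul_sub P, Matrix.sub_mul P, ← hX,
        sub_add_sub_cancel]
    _ ≤ ‖P‖ * ‖G - G₀‖ + (1 + ‖E‖) * (‖B‖ * ((g + g) * ‖G - G₀‖ * ‖P‖)) * g := by
      refine (norm_add_le _ _).trans (add_le_add (frobenius_norm_mul _ _)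
        ((frobenius_norm_mul _ _).trans ?_))
      gcongr
    _ = _ := by rw [hPX]; ring

end Auxiliary

/-- The subdifferential map `Φ X = ∂‖X‖_*` of the nuclear norm is
metrically sub-regular at every `X₀` for every `G₀ ∈ Φ X₀`: there are `κ, ε > 0` with
`d(X, Φ⁻¹ G₀) ≤ κ · d(G₀, Φ X)` (Frobenius distances) whenever `‖X - X₀‖_F ≤ ε`. -/
theorem nuclear_norm_subdifferential_metrically_subregular
    (m n : ℕ) (hmn : m ≤ n)
    (X₀ G₀ : Matrix (Fin m) (Fin n) ℝ) (hG₀ : G₀ ∈ nucSubdiff X₀) :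
    ∃ κ : ℝ, 0 < κ ∧ ∃ ε : ℝ, 0 < ε ∧
      ∀ X : Matrix (Fin m) (Fin n) ℝ, ‖X - X₀‖ ≤ ε → ∀ G ∈ nucSubdiff X,
        Metric.infDist X {Z : Matrix (Fin m) (Fin n) ℝ | G₀ ∈ nucSubdiff Z} ≤
          κ * ‖G - G₀‖ := by
  obtain ⟨c, hc, h⟩ := exists_infDist_le X₀ G₀ hG₀
  refine ⟨c * (‖X₀‖ + 1) + 1, by positivity, 1, one_pos, fun X hX G hG => (h X G hG).trans ?_⟩
  have hX' : ‖X‖ ≤ ‖X₀‖ + 1 := by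
    have := norm_le_norm_add_norm_sub' X X₀
    linarith
  gcongr
  have := mul_le_mul_of_nonneg_left hX' hc
  linarith
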